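/- Let A be an n×n positive semidefinite matrix over F with factor width at most k. Then rank(A) ≤ fran_k(A). Moreover, fran_k(A) ≤ n(n+1)/2 when F = ℝ, and fran_k(A) ≤ n² when F = ℂ. -/

import Mathlib

open Matrix
open scoped ComplexOrder

variable {𝕜 : Type*} [RCLike 𝕜] {n : ℕ}

/-- `A` has a decomposition as a sum of `r` outer products `v_j v_j*` where each
vector `v_j` has at most `k` nonzero entries. -/
def HasFWDecomp (k r : ℕ) (A : Matrix (Fin n) (Fin n) 𝕜) : Prop :=
  ∃ v : Fin r → (Fin n → 𝕜),
    (∀ j, ({i | v j i ≠ 0} : Set (Fin n)).ncard ≤ k) ∧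
    A = ∑ j, Matrix.vecMulVec (v j) (star (v j))

/-- `A` has factor width at most `k`. -/
def FactorWidthAtMost (k : ℕ) (A : Matrix (Fin n) (Fin n) 𝕜) : Prop :=
  ∃ r, HasFWDecomp k r A

/-- The factor-width-`k` rank of `A`: the least number of terms in a
factor-width-`k` decomposition of `A`. -/
noncomputable def fran (k : ℕ) (A : Matrix (Fin n) (Fin n) 𝕜) : ℕ :=
  sInf {r | HasFWDecomp k r A}

/-- The factor width of `A`: the least `k` such that `A` has factor width at most `k`. -/
noncomputable def FactorWidth (A : Matrix (Fin n) (Fin n) 𝕜) : ℕ :=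
  sInf {k | FactorWidthAtMost k A}

/-- A matrix with a factor-width decomposition attains its factor-width rank. -/
theorem HasFWDecomp.fran_spec {k r : ℕ} {A : Matrix (Fin n) (Fin n) 𝕜}
    (h : HasFWDecomp k r A) : HasFWDecomp k (fran k A) A :=
  Nat.sInf_mem (s := {r | HasFWDecomp k r A}) ⟨r, h⟩

theorem HasFWDecomp.rank_le {k r : ℕ} {A : Matrix (Fin n) (Fin n) 𝕜}
    (h : HasFWDecomp k r A) : A.rank ≤ r := by
  obtain ⟨v, -, rfl⟩ := h
  have hmul : ∑ j, vecMulVec (v j) (star (v j)) = (of v)ᵀ * (of v)ᵀᴴ := by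
    ext i l
    simp [mul_apply, Matrix.sum_apply, vecMulVec_apply]
  rw [hmul]
  exact (rank_mul_le_left _ _).trans (rank_le_width _)

/-- A linear relation with a positive coefficient among the outer products of a decomposition
allows one term to be removed. -/
theorem HasFWDecomp.remove_term {k r : ℕ} {v : Fin (r + 1) → Fin n → 𝕜}
    (hv : ∀ j, ({i | v j i ≠ 0} : Set (Fin n)).ncard ≤ k) {c : Fin (r + 1) → ℝ}
    (hc : ∑ j, c j • vecMulVec (v j) (star (v j)) = 0) {p : Fin (r + 1)} (hp : 0 < c p) :
    HasFWDecomp k r (∑ j, vecMulVec (v j) (star (v j))) := by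
  obtain ⟨m, hm⟩ := Finite.exists_max c
  have hm0 : 0 < c m := hp.trans_le (hm p)
  have hnonneg : ∀ j, 0 ≤ 1 - c j / c m := fun j => by
    rw [sub_nonneg, div_le_one hm0]
    exact hm j
  have hsum : ∑ j, vecMulVec (v j) (star (v j)) =
      ∑ j, (1 - c j / c m) • vecMulVec (v j) (star (v j)) := by
    have h0 : ∑ j, (c j / c m) • vecMulVec (v j) (star (v j)) = 0 := by
      simp_rw [div_eq_inv_mul, mul_smul, ← Finset.smul_sum, hc, smul_zero]
    simp_rw [sub_smul, one_smul, Finset.sum_sub_distrib, h0, sub_zero]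
  refine ⟨fun j => Real.sqrt (1 - c (m.succAbove j) / c m) • v (m.succAbove j),
    fun j => ?_, ?_⟩
  · refine (Set.ncard_le_ncard ?_ (Set.toFinite _)).trans (hv (m.succAbove j))
    intro i hi h0
    exact hi (by simp [h0])
  · rw [hsum, Fin.sum_univ_succAbove _ m, div_self hm0.ne', sub_self, zero_smul, zero_add]
    refine Finset.sum_congr rfl fun j _ => ?_
    rw [star_smul, star_trivial (Real.sqrt _), smul_vecMulVec, vecMulVec_smul, smul_smul,
      Real.mul_self_sqrt (hnonneg _)]

/-- The factor-width rank is at most the number of real linear functionals needed to separate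
Hermitian matrices from zero. -/
theorem fran_le_card {k : ℕ} {A : Matrix (Fin n) (Fin n) 𝕜} (hA : FactorWidthAtMost k A)
    {ι : Type*} [Fintype ι] (L : Matrix (Fin n) (Fin n) 𝕜 →ₗ[ℝ] (ι → ℝ))
    (hL : ∀ M : Matrix (Fin n) (Fin n) 𝕜, M.IsHermitian → L M = 0 → M = 0) :
    fran k A ≤ Fintype.card ι := by
  obtain ⟨r₀, h₀⟩ := hA
  obtain ⟨v, hv, hAv⟩ := h₀.fran_spec
  have hmin : ∀ r, HasFWDecomp k r A → fran k A ≤ r := fun r hr => Nat.sInf_le hr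
  generalize fran k A = r at v hv hAv hmin ⊢
  by_contra hlt
  have hdep : ¬ LinearIndependent ℝ fun j => L (vecMulVec (v j) (star (v j))) := by
    intro h
    exact hlt (by simpa using h.fintype_card_le_finrank)
  obtain ⟨c, hc, p, hp⟩ := Fintype.not_linearIndependent_iff.1 hdep
  have hc0 : ∑ j, c j • vecMulVec (v j) (star (v j)) = 0 := by
    refine hL _ ?_ (by simpa using hc)
    rw [IsHermitian, conjTranspose_sum]
    refine Finset.sum_congr rfl fun j _ => ?_
    rw [conjTranspose_smul, conjTranspose_vecMulVec, star_star, star_trivial]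
  obtain _ | r := r
  · exact p.elim0
  have hr : HasFWDecomp k r A := by
    rw [hAv]
    rcases hp.lt_or_gt with hneg | hpos
    · exact HasFWDecomp.remove_term hv (c := fun j => - c j)
        (by simp [neg_smul, hc0]) (neg_pos.2 hneg)
    · exact HasFWDecomp.remove_term hv hc0 hpos
  exact absurd (hmin r hr) (by simp)

theorem fran_real_le {k : ℕ} {A : Matrix (Fin n) (Fin n) ℝ} (hA : FactorWidthAtMost k A) :
    fran k A ≤ n * (n + 1) / 2 := by
  let L : Matrix (Fin n) (Fin n) ℝ →ₗ[ℝ] (Sym2 (Fin n) → ℝ) :=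
    LinearMap.pi fun s => Sym2.lift
      ⟨fun i j => entryLinearMap ℝ ℝ i j + entryLinearMap ℝ ℝ j i, fun _ _ => add_comm _ _⟩ s
  have h := fran_le_card hA L fun M hM h0 => by
    ext i j
    have hij : M i j + M j i = 0 := congrFun h0 s(i, j)
    have hji : M j i = M i j := by simpa using hM.apply i j
    simp only [Matrix.zero_apply]
    linarith
  rwa [Sym2.card, Fintype.card_fin, Nat.choose_two_right, Nat.add_sub_cancel, mul_comm] at h

theorem fran_complex_le {k : ℕ} {B : Matrix (Fin n) (Fin n) ℂ} (hB : FactorWidthAtMost k B) :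
    fran k B ≤ n ^ 2 := by
  let L : Matrix (Fin n) (Fin n) ℂ →ₗ[ℝ] (Fin n × Fin n → ℝ) :=
    LinearMap.pi fun s => (Complex.reLm + Complex.imLm) ∘ₗ entryLinearMap ℝ ℂ s.1 s.2
  have h := fran_le_card hB L fun M hM h0 => by
    ext i j
    have hij : (M i j).re + (M i j).im = 0 := congrFun h0 (i, j)
    have hji : (M j i).re + (M j i).im = 0 := congrFun h0 (j, i)
    rw [← hM.apply j i, Complex.star_def, Complex.conj_re, Complex.conj_im] at hji
    apply Complex.ext <;> simp only [Matrix.zero_apply, Complex.zero_re, Complex.zero_im] <;> linarith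
  simpa [sq] using h

theorem rank_le_fran_and_fran_le (k : ℕ)
    (A : Matrix (Fin n) (Fin n) ℝ) (hA : A.PosSemidef) (hAFW : FactorWidthAtMost k A)
    (B : Matrix (Fin n) (Fin n) ℂ) (hB : B.PosSemidef) (hBFW : FactorWidthAtMost k B) :
    (A.rank ≤ fran k A ∧ fran k A ≤ n * (n + 1) / 2) ∧
    (B.rank ≤ fran k B ∧ fran k B ≤ n ^ 2) := by
  obtain ⟨r, hr⟩ := hAFW
  obtain ⟨q, hq⟩ := hBFW
  exact ⟨⟨hr.fran_spec.rank_le, fran_real_le ⟨r, hr⟩⟩,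
    ⟨hq.fran_spec.rank_le, fran_complex_le ⟨q, hq⟩⟩⟩
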